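/- Let Γ′ ⊆ ℤ³ be the 28-element set consisting of (1,1,0), (5,−2,0), (−1,4,0), (3,−2,0), (−3,4,0), (1,2,0), (2,1,0), (0,2,0), (0,4,0), (1,4,0), (2,2,0), (2,4,0), (3,0,0), (3,1,0), (3,3,0), (3,5,0), (4,2,0), (4,4,0), (−2,1,1), (−1,−1,1), (−1,2,1), (0,3,1), (1,−1,1), (1,4,1), (2,0,1), (2,1,1), (3,2,1), (4,3,1), and let 𝒫 ⊆ ℕ³ be a set satisfying the P-position property for Γ′. Then the power series F = ∑_{p ∈ 𝒫} x^{p₁} y^{p₂} z^{p₃} in ℚ[[x,y,z]] is not rational: there do not exist polynomials P, Q ∈ ℚ[x,y,z] with Q having nonzero constant term and Q·F = P. -/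

import Mathlib

/-- The board ℕ³, viewed inside ℤ³. -/
def board3 : Set (ℤ × ℤ × ℤ) := {p | 0 ≤ p.1 ∧ 0 ≤ p.2.1 ∧ 0 ≤ p.2.2}

/-- `P ⊆ ℕ³` satisfies the P-position property for the ruleset `Γ`. -/
def PPosProperty (Γ : Finset (ℤ × ℤ × ℤ)) (P : Set (ℤ × ℤ × ℤ)) : Prop :=
  P ⊆ board3 ∧ ∀ p ∈ board3, (p ∈ P ↔ ∀ γ ∈ Γ, p - γ ∈ board3 → p - γ ∉ P)

/-- The explicit 28-element ruleset `Γ′`. -/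
def gammaPrime : Finset (ℤ × ℤ × ℤ) :=
  {(1,1,0), (5,-2,0), (-1,4,0), (3,-2,0), (-3,4,0), (1,2,0), (2,1,0),
   (0,2,0), (0,4,0), (1,4,0), (2,2,0), (2,4,0), (3,0,0), (3,1,0),
   (3,3,0), (3,5,0), (4,2,0), (4,4,0),
   (-2,1,1), (-1,-1,1), (-1,2,1), (0,3,1), (1,-1,1), (1,4,1),
   (2,0,1), (2,1,1), (3,2,1), (4,3,1)}

open Classical in
/-- The multigraded generating function `∑_{p ∈ P} x^{p₁} y^{p₂} z^{p₃}` of a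
set `P ⊆ ℕ³`, as a formal power series in three variables over `ℚ`. -/
noncomputable def genFun (P : Set (ℤ × ℤ × ℤ)) : MvPowerSeries (Fin 3) ℚ :=
  fun e => if ((e 0 : ℤ), (e 1 : ℤ), (e 2 : ℤ)) ∈ P then 1 else 0

lemma mem_congr {P : Set (ℤ × ℤ × ℤ)} {x y z x2 y2 z2 : ℤ} (h : (x, y, z) ∈ P)
    (hx : x = x2) (hy : y = y2) (hz : z = z2) : (x2, y2, z2) ∈ P := by
  subst hx hy hz
  exact h

/-- A legal move never joins two P-positions. -/
lemma not_mem_add {P : Set (ℤ × ℤ × ℤ)} (hP : PPosProperty gammaPrime P) {a b c : ℤ}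
    (hg : (a, b, c) ∈ gammaPrime) {x y z : ℤ} (h : (x, y, z) ∈ P) :
    (x + a, y + b, z + c) ∉ P := by
  intro hq
  have h1 := (hP.2 _ (hP.1 hq)).1 hq (a, b, c) hg
  have h2 : ((x + a, y + b, z + c) : ℤ × ℤ × ℤ) - (a, b, c) = (x, y, z) := by
    ext <;> simp
  rw [h2] at h1
  exact h1 (hP.1 h) h

/-- A position without moves to P-positions is a P-position. -/
lemma mem_of_forall {P : Set (ℤ × ℤ × ℤ)} (hP : PPosProperty gammaPrime P) {x y z : ℤ}
    (hx : 0 ≤ x) (hy : 0 ≤ y) (hz : 0 ≤ z)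
    (h : ∀ a b c, (a, b, c) ∈ gammaPrime → (x - a, y - b, z - c) ∉ P) : (x, y, z) ∈ P := by
  refine (hP.2 (x, y, z) ⟨hx, hy, hz⟩).2 ?_
  rintro ⟨a, b, c⟩ hg -
  exact h a b c hg

lemma nonneg_of_mem {P : Set (ℤ × ℤ × ℤ)} (hP : PPosProperty gammaPrime P) {x y z : ℤ}
    (h : (x, y, z) ∈ P) : 0 ≤ x ∧ 0 ≤ y ∧ 0 ≤ z := hP.1 h

/-- The bottom slice. -/
def bottom (x y : ℤ) : Prop := (y % 6 = 0 ∧ x % 6 ≤ 2) ∨ (x % 6 = 0 ∧ y % 6 = 1)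

lemma mem_gammaPrime_cases_aux : ∀ g ∈ gammaPrime,
    (g.2.2 = 0 ∧ ((g.1 = 1 ∧ g.2.1 = 1) ∨ (g.1 = 5 ∧ g.2.1 = -2) ∨ (g.1 = -1 ∧ g.2.1 = 4) ∨ (g.1 = 3 ∧ g.2.1 = -2) ∨
      (g.1 = -3 ∧ g.2.1 = 4) ∨ (g.1 = 1 ∧ g.2.1 = 2) ∨ (g.1 = 2 ∧ g.2.1 = 1) ∨ (g.1 = 0 ∧ g.2.1 = 2) ∨
      (g.1 = 0 ∧ g.2.1 = 4) ∨ (g.1 = 1 ∧ g.2.1 = 4) ∨ (g.1 = 2 ∧ g.2.1 = 2) ∨ (g.1 = 2 ∧ g.2.1 = 4) ∨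
      (g.1 = 3 ∧ g.2.1 = 0) ∨ (g.1 = 3 ∧ g.2.1 = 1) ∨ (g.1 = 3 ∧ g.2.1 = 3) ∨ (g.1 = 3 ∧ g.2.1 = 5) ∨
      (g.1 = 4 ∧ g.2.1 = 2) ∨ (g.1 = 4 ∧ g.2.1 = 4))) ∨
    (g.2.2 = 1 ∧ ((g.1 = -2 ∧ g.2.1 = 1) ∨ (g.1 = -1 ∧ g.2.1 = -1) ∨ (g.1 = -1 ∧ g.2.1 = 2) ∨ (g.1 = 0 ∧ g.2.1 = 3) ∨
      (g.1 = 1 ∧ g.2.1 = -1) ∨ (g.1 = 1 ∧ g.2.1 = 4) ∨ (g.1 = 2 ∧ g.2.1 = 0) ∨ (g.1 = 2 ∧ g.2.1 = 1) ∨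
      (g.1 = 3 ∧ g.2.1 = 2) ∨ (g.1 = 4 ∧ g.2.1 = 3))) := by
  decide

lemma mem_gammaPrime_cases {a b c : ℤ} (h : (a, b, c) ∈ gammaPrime) :
    (c = 0 ∧ ((a = 1 ∧ b = 1) ∨ (a = 5 ∧ b = -2) ∨ (a = -1 ∧ b = 4) ∨ (a = 3 ∧ b = -2) ∨
      (a = -3 ∧ b = 4) ∨ (a = 1 ∧ b = 2) ∨ (a = 2 ∧ b = 1) ∨ (a = 0 ∧ b = 2) ∨
      (a = 0 ∧ b = 4) ∨ (a = 1 ∧ b = 4) ∨ (a = 2 ∧ b = 2) ∨ (a = 2 ∧ b = 4) ∨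
      (a = 3 ∧ b = 0) ∨ (a = 3 ∧ b = 1) ∨ (a = 3 ∧ b = 3) ∨ (a = 3 ∧ b = 5) ∨
      (a = 4 ∧ b = 2) ∨ (a = 4 ∧ b = 4))) ∨
    (c = 1 ∧ ((a = -2 ∧ b = 1) ∨ (a = -1 ∧ b = -1) ∨ (a = -1 ∧ b = 2) ∨ (a = 0 ∧ b = 3) ∨
      (a = 1 ∧ b = -1) ∨ (a = 1 ∧ b = 4) ∨ (a = 2 ∧ b = 0) ∨ (a = 2 ∧ b = 1) ∨
      (a = 3 ∧ b = 2) ∨ (a = 4 ∧ b = 3))) :=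
  mem_gammaPrime_cases_aux _ h

lemma bottom_indep {x y a b : ℤ} (hg : (a, b, 0) ∈ gammaPrime) (h : bottom x y) :
    ¬ bottom (x - a) (y - b) := by
  unfold bottom at *
  rcases mem_gammaPrime_cases hg with ⟨-, hc⟩ | ⟨hc, -⟩
  · rcases hc with ⟨rfl, rfl⟩ | ⟨rfl, rfl⟩ | ⟨rfl, rfl⟩ | ⟨rfl, rfl⟩ | ⟨rfl, rfl⟩ | ⟨rfl, rfl⟩ |
      ⟨rfl, rfl⟩ | ⟨rfl, rfl⟩ | ⟨rfl, rfl⟩ | ⟨rfl, rfl⟩ | ⟨rfl, rfl⟩ | ⟨rfl, rfl⟩ |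
      ⟨rfl, rfl⟩ | ⟨rfl, rfl⟩ | ⟨rfl, rfl⟩ | ⟨rfl, rfl⟩ | ⟨rfl, rfl⟩ | ⟨rfl, rfl⟩ <;> omega
  · omega

lemma bottom_absorb {x y : ℤ} (hx : 0 ≤ x) (hy : 0 ≤ y) (h : ¬ bottom x y) :
    ∃ a b, (a, b, (0 : ℤ)) ∈ gammaPrime ∧ 0 ≤ x - a ∧ 0 ≤ y - b ∧ bottom (x - a) (y - b) := by
  unfold bottom at *
  have hr : x % 6 = 0 ∨ x % 6 = 1 ∨ x % 6 = 2 ∨ x % 6 = 3 ∨ x % 6 = 4 ∨ x % 6 = 5 := by omega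
  have hs : y % 6 = 0 ∨ y % 6 = 1 ∨ y % 6 = 2 ∨ y % 6 = 3 ∨ y % 6 = 4 ∨ y % 6 = 5 := by omega
  rcases hr with hr | hr | hr | hr | hr | hr <;> rcases hs with hs | hs | hs | hs | hs | hs
  · exfalso; omega
  · exfalso; omega
  · exact ⟨0, 2, by decide, by omega, by omega, by omega⟩
  · exact ⟨0, 2, by decide, by omega, by omega, by omega⟩
  · exact ⟨-1, 4, by decide, by omega, by omega, by omega⟩
  · exact ⟨0, 4, by decide, by omega, by omega, by omega⟩
  · exfalso; omega
  · exact ⟨1, 1, by decide, by omega, by omega, by omega⟩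
  · exact ⟨1, 1, by decide, by omega, by omega, by omega⟩
  · exact ⟨1, 2, by decide, by omega, by omega, by omega⟩
  · exact ⟨-1, 4, by decide, by omega, by omega, by omega⟩
  · exact ⟨1, 4, by decide, by omega, by omega, by omega⟩
  · exfalso; omega
  · exact ⟨1, 1, by decide, by omega, by omega, by omega⟩
  · exact ⟨1, 2, by decide, by omega, by omega, by omega⟩
  · exact ⟨2, 2, by decide, by omega, by omega, by omega⟩
  · exact ⟨0, 4, by decide, by omega, by omega, by omega⟩
  · exact ⟨2, 4, by decide, by omega, by omega, by omega⟩
  · exact ⟨3, 0, by decide, by omega, by omega, by omega⟩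
  · exact ⟨1, 1, by decide, by omega, by omega, by omega⟩
  · exact ⟨1, 2, by decide, by omega, by omega, by omega⟩
  · exact ⟨3, 3, by decide, by omega, by omega, by omega⟩
  · exact ⟨3, -2, by decide, by omega, by omega, by omega⟩
  · exact ⟨3, -2, by decide, by omega, by omega, by omega⟩
  · exact ⟨3, 0, by decide, by omega, by omega, by omega⟩
  · exact ⟨2, 1, by decide, by omega, by omega, by omega⟩
  · exact ⟨2, 2, by decide, by omega, by omega, by omega⟩
  · exact ⟨3, 3, by decide, by omega, by omega, by omega⟩
  · exact ⟨3, -2, by decide, by omega, by omega, by omega⟩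
  · exact ⟨3, 5, by decide, by omega, by omega, by omega⟩
  · exact ⟨3, 0, by decide, by omega, by omega, by omega⟩
  · exact ⟨3, 1, by decide, by omega, by omega, by omega⟩
  · exact ⟨4, 2, by decide, by omega, by omega, by omega⟩
  · exact ⟨3, 3, by decide, by omega, by omega, by omega⟩
  · exact ⟨5, -2, by decide, by omega, by omega, by omega⟩
  · exact ⟨5, -2, by decide, by omega, by omega, by omega⟩

lemma mem_bottom {P : Set (ℤ × ℤ × ℤ)} (hP : PPosProperty gammaPrime P) :
    ∀ n : ℕ, ∀ x y : ℤ, 0 ≤ x → 0 ≤ y → 3 * x + 4 * y < n → ((x, y, 0) ∈ P ↔ bottom x y) := by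
  intro n
  induction n with
  | zero => intro x y hx hy h; push_cast at h; omega
  | succ n ih =>
    intro x y hx hy hn
    push_cast at hn
    have pos : ∀ a b : ℤ, (a, b, (0 : ℤ)) ∈ gammaPrime → 0 < 3 * a + 4 * b := by
      intro a b hg
      have := mem_gammaPrime_cases hg
      omega
    constructor
    · intro h
      by_contra hb
      obtain ⟨a, b, hg, ha, hbn, hbot⟩ := bottom_absorb hx hy hb
      have hp := pos a b hg
      have h1 := (ih (x - a) (y - b) ha hbn (by omega)).2 hbot
      have h2 := not_mem_add hP hg h1
      simp at h2
      exact h2 h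
    · intro h
      refine mem_of_forall hP hx hy le_rfl ?_
      intro a b c hg hmem
      have hnn := nonneg_of_mem hP hmem
      have hc : c = 0 := by
        have := mem_gammaPrime_cases hg
        omega
      subst hc
      have hp := pos a b hg
      rw [sub_zero] at hmem
      exact bottom_indep hg h ((ih _ _ hnn.1 hnn.2.1 (by omega)).1 hmem)

lemma mem_zero {P : Set (ℤ × ℤ × ℤ)} (hP : PPosProperty gammaPrime P) {x y : ℤ}
    (hx : 0 ≤ x) (hy : 0 ≤ y) : (x, y, 0) ∈ P ↔ bottom x y :=
  mem_bottom hP ((3 * x + 4 * y).toNat + 1) x y hx hy (by push_cast; omega)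

/-- The residue classes carrying P-positions in the slice `z = 1`. -/
def special (x y : ℤ) : Prop :=
  (x % 6 = 0 ∧ y % 6 = 0) ∨ (x % 6 = 1 ∧ y % 6 = 1) ∨ (x % 6 = 4 ∧ y % 6 = 5) ∨
    (x % 6 = 5 ∧ y % 6 = 4)

lemma special_absorb {x y : ℤ} (hx : 0 ≤ x) (hy : 0 ≤ y) (h : ¬ special x y) :
    ∃ a b, (a, b, (1 : ℤ)) ∈ gammaPrime ∧ 0 ≤ x - a ∧ 0 ≤ y - b ∧ bottom (x - a) (y - b) := by
  unfold bottom
  unfold special at h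
  have hr : x % 6 = 0 ∨ x % 6 = 1 ∨ x % 6 = 2 ∨ x % 6 = 3 ∨ x % 6 = 4 ∨ x % 6 = 5 := by omega
  have hs : y % 6 = 0 ∨ y % 6 = 1 ∨ y % 6 = 2 ∨ y % 6 = 3 ∨ y % 6 = 4 ∨ y % 6 = 5 := by omega
  rcases hr with hr | hr | hr | hr | hr | hr <;> rcases hs with hs | hs | hs | hs | hs | hs
  · exfalso; omega
  · exact ⟨-2, 1, by decide, by omega, by omega, by omega⟩
  · exact ⟨-1, 2, by decide, by omega, by omega, by omega⟩
  · exact ⟨0, 3, by decide, by omega, by omega, by omega⟩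
  · exact ⟨0, 3, by decide, by omega, by omega, by omega⟩
  · exact ⟨-1, -1, by decide, by omega, by omega, by omega⟩
  · exact ⟨1, -1, by decide, by omega, by omega, by omega⟩
  · exfalso; omega
  · exact ⟨-1, 2, by decide, by omega, by omega, by omega⟩
  · exact ⟨0, 3, by decide, by omega, by omega, by omega⟩
  · exact ⟨1, 4, by decide, by omega, by omega, by omega⟩
  · exact ⟨-1, -1, by decide, by omega, by omega, by omega⟩
  · exact ⟨2, 0, by decide, by omega, by omega, by omega⟩
  · exact ⟨2, 0, by decide, by omega, by omega, by omega⟩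
  · exact ⟨2, 1, by decide, by omega, by omega, by omega⟩
  · exact ⟨0, 3, by decide, by omega, by omega, by omega⟩
  · exact ⟨1, 4, by decide, by omega, by omega, by omega⟩
  · exact ⟨1, -1, by decide, by omega, by omega, by omega⟩
  · exact ⟨2, 0, by decide, by omega, by omega, by omega⟩
  · exact ⟨2, 1, by decide, by omega, by omega, by omega⟩
  · exact ⟨3, 2, by decide, by omega, by omega, by omega⟩
  · exact ⟨3, 2, by decide, by omega, by omega, by omega⟩
  · exact ⟨1, 4, by decide, by omega, by omega, by omega⟩
  · exact ⟨1, -1, by decide, by omega, by omega, by omega⟩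
  · exact ⟨2, 0, by decide, by omega, by omega, by omega⟩
  · exact ⟨-2, 1, by decide, by omega, by omega, by omega⟩
  · exact ⟨-2, 1, by decide, by omega, by omega, by omega⟩
  · exact ⟨4, 3, by decide, by omega, by omega, by omega⟩
  · exact ⟨4, 3, by decide, by omega, by omega, by omega⟩
  · exfalso; omega
  · exact ⟨-1, -1, by decide, by omega, by omega, by omega⟩
  · exact ⟨-2, 1, by decide, by omega, by omega, by omega⟩
  · exact ⟨-1, 2, by decide, by omega, by omega, by omega⟩
  · exact ⟨-1, 2, by decide, by omega, by omega, by omega⟩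
  · exfalso; omega
  · exact ⟨-1, -1, by decide, by omega, by omega, by omega⟩

lemma special_of_mem {P : Set (ℤ × ℤ × ℤ)} (hP : PPosProperty gammaPrime P) {x y : ℤ}
    (h : (x, y, 1) ∈ P) : special x y := by
  by_contra hs
  have hnn := nonneg_of_mem hP h
  obtain ⟨a, b, hg, ha, hb, hbot⟩ := special_absorb hnn.1 hnn.2.1 hs
  have h2 := not_mem_add hP hg ((mem_zero hP ha hb).2 hbot)
  simp at h2
  exact h2 h

/-- From a special position the moves down to `z = 0` are never to P-positions,
so only moves inside the slice matter. -/
lemma special_mem {P : Set (ℤ × ℤ × ℤ)} (hP : PPosProperty gammaPrime P) {x y : ℤ}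
    (hx : 0 ≤ x) (hy : 0 ≤ y) (hs : special x y)
    (h : ∀ a b, (a, b, (0 : ℤ)) ∈ gammaPrime → special (x - a) (y - b) → (x - a, y - b, 1) ∉ P) :
    (x, y, 1) ∈ P := by
  refine mem_of_forall hP hx hy zero_le_one ?_
  intro a b c hg hmem
  have hnn := nonneg_of_mem hP hmem
  have hc := mem_gammaPrime_cases hg
  by_cases h0 : c = 0
  · subst h0
    rw [sub_zero] at hmem
    exact h a b hg (special_of_mem hP hmem) hmem
  · have h1 : c = 1 := by omega
    subst h1
    rw [sub_self] at hmem
    have hb := (mem_zero hP hnn.1 hnn.2.1).1 hmem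
    rcases hc with ⟨h00, -⟩ | ⟨-, hc⟩
    · omega
    · unfold bottom at hb
      unfold special at hs
      rcases hc with ⟨rfl, rfl⟩ | ⟨rfl, rfl⟩ | ⟨rfl, rfl⟩ | ⟨rfl, rfl⟩ | ⟨rfl, rfl⟩ |
        ⟨rfl, rfl⟩ | ⟨rfl, rfl⟩ | ⟨rfl, rfl⟩ | ⟨rfl, rfl⟩ | ⟨rfl, rfl⟩ <;> omega

/-- The cell variable. -/
def cell (P : Set (ℤ × ℤ × ℤ)) (i j : ℤ) : Prop := (6 * i, 6 * j, (1 : ℤ)) ∈ P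

lemma mem_11 {P : Set (ℤ × ℤ × ℤ)} (hP : PPosProperty gammaPrime P) {i j : ℤ}
    (hi : 0 ≤ i) (hj : 0 ≤ j) : (6 * i + 1, 6 * j + 1, 1) ∈ P ↔ ¬ cell P i j := by
  constructor
  · intro h hc
    exact not_mem_add hP (a := 1) (b := 1) (c := 0) (by decide) hc (by simpa using h)
  · intro hc
    refine special_mem hP (by omega) (by omega) (by unfold special; omega) ?_
    intro a b hg hs hmem
    have hab : a = 1 ∧ b = 1 := by
      have hc := mem_gammaPrime_cases hg
      unfold special at hs
      omega
    obtain ⟨rfl, rfl⟩ := hab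
    apply hc
    simpa [cell] using hmem

lemma mem_45 {P : Set (ℤ × ℤ × ℤ)} (hP : PPosProperty gammaPrime P) {i j : ℤ}
    (hi : 0 ≤ i) (hj : 0 ≤ j) :
    (6 * i + 4, 6 * j + 5, 1) ∈ P ↔ (cell P (i + 1) j ∧ cell P i (j + 1)) := by
  constructor
  · intro h
    constructor
    · by_contra hc
      have h1 := not_mem_add hP (a := -3) (b := 4) (c := 0) (by decide)
        ((mem_11 hP (by omega) hj).2 hc)
      apply h1
      exact mem_congr h (by ring) (by ring) (by ring)
    · by_contra hc
      have h1 := not_mem_add hP (a := 3) (b := -2) (c := 0) (by decide)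
        ((mem_11 hP hi (by omega)).2 hc)
      apply h1
      exact mem_congr h (by ring) (by ring) (by ring)
  · rintro ⟨h1, h2⟩
    refine special_mem hP (by omega) (by omega) (by unfold special; omega) ?_
    intro a b hg hs hmem
    have hab : (a = -3 ∧ b = 4) ∨ (a = 3 ∧ b = -2) := by
      have hc := mem_gammaPrime_cases hg
      unfold special at hs
      omega
    rcases hab with ⟨rfl, rfl⟩ | ⟨rfl, rfl⟩
    · refine (mem_11 hP (by omega) hj).1 ?_ h1
      exact mem_congr hmem (by ring) (by ring) (by ring)
    · refine (mem_11 hP hi (by omega)).1 ?_ h2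
      exact mem_congr hmem (by ring) (by ring) (by ring)

lemma mem_54 {P : Set (ℤ × ℤ × ℤ)} (hP : PPosProperty gammaPrime P) {i j : ℤ}
    (hi : 0 ≤ i) (hj : 0 ≤ j) :
    (6 * i + 5, 6 * j + 4, 1) ∈ P ↔ (¬ cell P (i + 1) j ∧ ¬ cell P i (j + 1)) := by
  constructor
  · intro h
    constructor
    · intro hc
      have h1 := not_mem_add hP (a := -1) (b := 4) (c := 0) (by decide) hc
      apply h1
      exact mem_congr h (by ring) (by ring) (by ring)
    · intro hc
      have h1 := not_mem_add hP (a := 5) (b := -2) (c := 0) (by decide) hc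
      apply h1
      exact mem_congr h (by ring) (by ring) (by ring)
  · rintro ⟨h1, h2⟩
    refine special_mem hP (by omega) (by omega) (by unfold special; omega) ?_
    intro a b hg hs hmem
    have hab : (a = -1 ∧ b = 4) ∨ (a = 5 ∧ b = -2) := by
      have hc := mem_gammaPrime_cases hg
      unfold special at hs
      omega
    rcases hab with ⟨rfl, rfl⟩ | ⟨rfl, rfl⟩
    · refine h1 ?_
      unfold cell
      exact mem_congr hmem (by ring) (by ring) (by ring)
    · refine h2 ?_
      unfold cell
      exact mem_congr hmem (by ring) (by ring) (by ring)

lemma cell_iff {P : Set (ℤ × ℤ × ℤ)} (hP : PPosProperty gammaPrime P) {i j : ℤ}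
    (hi : 0 ≤ i) (hj : 0 ≤ j) :
    cell P i j ↔ ((6 * (i - 1) + 5, 6 * (j - 1) + 4, (1 : ℤ)) ∉ P ∧
      (6 * (i - 1) + 4, 6 * (j - 1) + 5, (1 : ℤ)) ∉ P) := by
  constructor
  · intro h
    constructor
    · intro hc
      have h1 := not_mem_add hP (a := 1) (b := 2) (c := 0) (by decide) hc
      apply h1
      unfold cell at h
      exact mem_congr h (by ring) (by ring) (by ring)
    · intro hc
      have h1 := not_mem_add hP (a := 2) (b := 1) (c := 0) (by decide) hc
      apply h1
      unfold cell at h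
      exact mem_congr h (by ring) (by ring) (by ring)
  · rintro ⟨h1, h2⟩
    refine special_mem hP (by omega) (by omega) (by unfold special; omega) ?_
    intro a b hg hs hmem
    have hab : (a = 1 ∧ b = 2) ∨ (a = 2 ∧ b = 1) := by
      have hc := mem_gammaPrime_cases hg
      unfold special at hs
      omega
    rcases hab with ⟨rfl, rfl⟩ | ⟨rfl, rfl⟩
    · refine h1 ?_
      exact mem_congr hmem (by ring) (by ring) (by ring)
    · refine h2 ?_
      exact mem_congr hmem (by ring) (by ring) (by ring)

lemma cell_zero_left {P : Set (ℤ × ℤ × ℤ)} (hP : PPosProperty gammaPrime P) {j : ℤ}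
    (hj : 0 ≤ j) : cell P 0 j := by
  rw [cell_iff hP le_rfl hj]
  constructor <;> intro h <;> have := (nonneg_of_mem hP h).1 <;> omega

lemma cell_zero_right {P : Set (ℤ × ℤ × ℤ)} (hP : PPosProperty gammaPrime P) {i : ℤ}
    (hi : 0 ≤ i) : cell P i 0 := by
  rw [cell_iff hP hi le_rfl]
  constructor <;> intro h <;> have := (nonneg_of_mem hP h).2.1 <;> omega

lemma cell_succ {P : Set (ℤ × ℤ × ℤ)} (hP : PPosProperty gammaPrime P) {i j : ℤ}
    (hi : 0 ≤ i) (hj : 0 ≤ j) :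
    cell P (i + 1) (j + 1) ↔ ¬ (cell P (i + 1) j ↔ cell P i (j + 1)) := by
  rw [cell_iff hP (by omega) (by omega)]
  rw [add_sub_cancel_right, add_sub_cancel_right, mem_54 hP hi hj, mem_45 hP hi hj]
  tauto

lemma cell_choose {P : Set (ℤ × ℤ × ℤ)} (hP : PPosProperty gammaPrime P) :
    ∀ n : ℕ, ∀ i j : ℕ, i + j = n → (cell P i j ↔ Odd (Nat.choose (i + j) i)) := by
  intro n
  induction n with
  | zero =>
    intro i j h
    obtain ⟨rfl, rfl⟩ : i = 0 ∧ j = 0 := by omega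
    simpa using cell_zero_left hP le_rfl
  | succ n ih =>
    intro i j h
    rcases i with _ | i
    · simpa using cell_zero_left hP (by omega)
    rcases j with _ | j
    · simpa using cell_zero_right hP (i := i + 1) (by omega)
    push_cast
    rw [cell_succ hP (by omega) (by omega)]
    have h1 := ih (i + 1) j (by omega)
    have h2 := ih i (j + 1) (by omega)
    push_cast at h1 h2
    rw [h1, h2]
    have h3 : Nat.choose (i + 1 + (j + 1)) (i + 1)
        = Nat.choose (i + (j + 1)) i + Nat.choose (i + 1 + j) (i + 1) := by
      rw [show i + 1 + (j + 1) = (i + (j + 1)) + 1 by ring, Nat.choose_succ_succ,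
        show i + 1 + j = i + (j + 1) by ring]
    rw [h3, Nat.odd_add, ← Nat.not_odd_iff_even]
    tauto

/-- The large empty triangle. -/
lemma cell_triangle {P : Set (ℤ × ℤ × ℤ)} (hP : PPosProperty gammaPrime P) (n : ℕ) :
    ∀ d i j : ℕ, i + j = 2 ^ n + d → i < 2 ^ n → j < 2 ^ n → ¬ cell P i j := by
  intro d
  induction d with
  | zero =>
    intro i j h hi hj
    rw [cell_choose hP _ i j rfl, h, add_zero, Nat.not_odd_iff_even, even_iff_two_dvd]
    exact Nat.prime_two.dvd_choose_pow (by omega) (by omega)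
  | succ d ih =>
    intro i j h hi hj
    rcases i with _ | i
    · omega
    rcases j with _ | j
    · omega
    have h1 := ih (i + 1) j (by omega) (by omega) (by omega)
    have h2 := ih i (j + 1) (by omega) (by omega) (by omega)
    push_cast at *
    rw [cell_succ hP (by omega) (by omega)]
    tauto

lemma cell_right {P : Set (ℤ × ℤ × ℤ)} (hP : PPosProperty gammaPrime P) (n : ℕ) :
    ∀ j : ℕ, j < 2 ^ n → cell P (2 ^ n : ℕ) j := by
  intro j
  induction j with
  | zero => intro _; exact cell_zero_right hP (by omega)
  | succ j ih =>
    intro hj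
    have h1 := ih (by omega)
    obtain ⟨m, hm⟩ : ∃ m, 2 ^ n = m + 1 := ⟨2 ^ n - 1, by have := Nat.two_pow_pos n; omega⟩
    have h2 := cell_triangle hP n j m (j + 1) (by omega) (by omega) (by omega)
    rw [hm] at h1 ⊢
    push_cast at *
    rw [cell_succ hP (by omega) (by omega)]
    tauto

lemma cell_top {P : Set (ℤ × ℤ × ℤ)} (hP : PPosProperty gammaPrime P) (n : ℕ) :
    ∀ i : ℕ, i < 2 ^ n → cell P i (2 ^ n : ℕ) := by
  intro i
  induction i with
  | zero => intro _; exact cell_zero_left hP (by omega)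
  | succ i ih =>
    intro hi
    have h1 := ih (by omega)
    obtain ⟨m, hm⟩ : ∃ m, 2 ^ n = m + 1 := ⟨2 ^ n - 1, by have := Nat.two_pow_pos n; omega⟩
    have h2 := cell_triangle hP n i (i + 1) m (by omega) (by omega) (by omega)
    rw [hm] at h1 ⊢
    push_cast at *
    rw [cell_succ hP (by omega) (by omega)]
    tauto

/-- Near the far corner of the empty triangle, membership in the slice `z = 1` is
periodic in the `x`-direction, except at the corner itself. -/
lemma window {P : Set (ℤ × ℤ × ℤ)} (hP : PPosProperty gammaPrime P) (n : ℕ) (N : ℤ)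
    (hN : N = ((2 ^ n : ℕ) : ℤ)) (x y : ℤ) (hx : x ≤ 6 * N - 2) (hy : y ≤ 6 * N - 1)
    (hxl : 4 * N + 20 ≤ x) (hyl : 4 * N + 20 ≤ y) (hne : ¬ (x = 6 * N - 2 ∧ y = 6 * N - 1)) :
    (x, y, (1 : ℤ)) ∈ P ↔ (x - 6, y, (1 : ℤ)) ∈ P := by
  have hpos : 0 < N := by rw [hN]; exact_mod_cast Nat.two_pow_pos n
  have tri : ∀ i j : ℤ, 0 ≤ i → 0 ≤ j → i < N → j < N → N ≤ i + j → ¬ cell P i j := by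
    intro i j hi hj hiN hjN h
    lift i to ℕ using hi
    lift j to ℕ using hj
    exact cell_triangle hP n (i + j - 2 ^ n) i j (by omega) (by omega) (by omega)
  have top : ∀ i : ℤ, 0 ≤ i → i < N → cell P i N := by
    intro i hi hiN
    lift i to ℕ using hi
    rw [hN]
    exact cell_top hP n i (by omega)
  by_cases hs : special x y
  swap
  · constructor
    · intro h; exact absurd (special_of_mem hP h) hs
    · intro h
      have := special_of_mem hP h
      unfold special at *
      omega
  obtain ⟨i, hi⟩ : ∃ i, i = x / 6 := ⟨_, rfl⟩
  obtain ⟨j, hj⟩ : ∃ j, j = y / 6 := ⟨_, rfl⟩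
  rcases hs with ⟨h1, h2⟩ | ⟨h1, h2⟩ | ⟨h1, h2⟩ | ⟨h1, h2⟩
  · obtain rfl : x = 6 * i := by omega
    obtain rfl : y = 6 * j := by omega
    have a1 := tri i j (by omega) (by omega) (by omega) (by omega) (by omega)
    have a2 := tri (i - 1) j (by omega) (by omega) (by omega) (by omega) (by omega)
    unfold cell at a1 a2
    rw [show 6 * i - 6 = 6 * (i - 1) by ring]
    tauto
  · obtain rfl : x = 6 * i + 1 := by omega
    obtain rfl : y = 6 * j + 1 := by omega
    have a1 := tri i j (by omega) (by omega) (by omega) (by omega) (by omega)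
    have a2 := tri (i - 1) j (by omega) (by omega) (by omega) (by omega) (by omega)
    rw [show 6 * i + 1 - 6 = 6 * (i - 1) + 1 by ring, mem_11 hP (by omega) (by omega),
      mem_11 hP (by omega) (by omega)]
    tauto
  · obtain rfl : x = 6 * i + 4 := by omega
    obtain rfl : y = 6 * j + 5 := by omega
    have a2 := tri i j (by omega) (by omega) (by omega) (by omega) (by omega)
    rw [show 6 * i + 4 - 6 = 6 * (i - 1) + 4 by ring, mem_45 hP (by omega) (by omega),
      mem_45 hP (by omega) (by omega), sub_add_cancel]
    by_cases hiN : i + 1 < N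
    · have a1 := tri (i + 1) j (by omega) (by omega) (by omega) (by omega) (by omega)
      tauto
    · have a1 := tri i (j + 1) (by omega) (by omega) (by omega) (by omega) (by omega)
      tauto
  · obtain rfl : x = 6 * i + 5 := by omega
    obtain rfl : y = 6 * j + 4 := by omega
    have a1 := tri (i + 1) j (by omega) (by omega) (by omega) (by omega) (by omega)
    have a2 := tri i j (by omega) (by omega) (by omega) (by omega) (by omega)
    rw [show 6 * i + 5 - 6 = 6 * (i - 1) + 5 by ring, mem_54 hP (by omega) (by omega),
      mem_54 hP (by omega) (by omega), sub_add_cancel]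
    by_cases hjN : j + 1 < N
    · have b1 := tri i (j + 1) (by omega) (by omega) (by omega) (by omega) (by omega)
      have b2 := tri (i - 1) (j + 1) (by omega) (by omega) (by omega) (by omega) (by omega)
      tauto
    · obtain hjN : j + 1 = N := by omega
      have b1 := top i (by omega) (by omega)
      have b2 := top (i - 1) (by omega) (by omega)
      rw [hjN]
      tauto

/-- The corner of the triangle. -/
lemma corner {P : Set (ℤ × ℤ × ℤ)} (hP : PPosProperty gammaPrime P) (n : ℕ) (N : ℤ)
    (hN : N = ((2 ^ n : ℕ) : ℤ)) (h4 : 4 ≤ N) :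
    (6 * N - 2, 6 * N - 1, (1 : ℤ)) ∈ P ∧ (6 * N - 2 - 6, 6 * N - 1, (1 : ℤ)) ∉ P := by
  obtain ⟨m, hm⟩ : ∃ m : ℕ, 2 ^ n = m + 1 := ⟨2 ^ n - 1, by have := Nat.two_pow_pos n; omega⟩
  have hr := cell_right hP n m (by omega)
  have ht := cell_top hP n m (by omega)
  have htr := cell_triangle hP n (m - 1) m m (by omega) (by omega) (by omega)
  obtain rfl : N = (m : ℤ) + 1 := by rw [hN, hm]; push_cast; ring
  rw [hm] at hr ht
  push_cast at hr ht
  constructor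
  · rw [show 6 * ((m : ℤ) + 1) - 2 = 6 * m + 4 by ring,
      show 6 * ((m : ℤ) + 1) - 1 = 6 * m + 5 by ring, mem_45 hP (by omega) (by omega)]
    exact ⟨hr, ht⟩
  · rw [show 6 * ((m : ℤ) + 1) - 2 - 6 = 6 * ((m : ℤ) - 1) + 4 by ring,
      show 6 * ((m : ℤ) + 1) - 1 = 6 * m + 5 by ring, mem_45 hP (by omega) (by omega),
      sub_add_cancel]
    tauto

open Classical in
/-- The rational-valued indicator function of a set of positions. -/
noncomputable def indic (P : Set (ℤ × ℤ × ℤ)) (p : ℤ × ℤ × ℤ) : ℚ := if p ∈ P then 1 else 0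

lemma coeff_mul_genFun {P : Set (ℤ × ℤ × ℤ)} (hP : PPosProperty gammaPrime P)
    (Q : MvPolynomial (Fin 3) ℚ) (m : Fin 3 →₀ ℕ) :
    MvPowerSeries.coeff m ((Q : MvPowerSeries (Fin 3) ℚ) * genFun P) =
      ∑ a ∈ Q.support, MvPolynomial.coeff a Q *
        indic P ((m 0 : ℤ) - a 0, (m 1 : ℤ) - a 1, (m 2 : ℤ) - a 2) := by
  have hQ : (Q : MvPowerSeries (Fin 3) ℚ) =
      ∑ a ∈ Q.support, MvPowerSeries.monomial a (MvPolynomial.coeff a Q) := by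
    conv_lhs => rw [Q.as_sum]
    rw [← MvPolynomial.coeToMvPowerSeries.ringHom_apply, map_sum]
    simp
  rw [hQ, Finset.sum_mul, map_sum]
  refine Finset.sum_congr rfl fun a _ => ?_
  rw [MvPowerSeries.coeff_monomial_mul]
  split_ifs with h
  · congr 1
    have h0 := h 0
    have h1 := h 1
    have h2 := h 2
    have e0 : (((m - a) 0 : ℕ) : ℤ) = (m 0 : ℤ) - a 0 := by
      rw [Finsupp.tsub_apply, Nat.cast_sub h0]
    have e1 : (((m - a) 1 : ℕ) : ℤ) = (m 1 : ℤ) - a 1 := by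
      rw [Finsupp.tsub_apply, Nat.cast_sub h1]
    have e2 : (((m - a) 2 : ℕ) : ℤ) = (m 2 : ℤ) - a 2 := by
      rw [Finsupp.tsub_apply, Nat.cast_sub h2]
    rw [← e0, ← e1, ← e2]
    rfl
  · symm
    apply mul_eq_zero_of_right
    unfold indic
    rw [if_neg]
    intro hmem
    have hnn := nonneg_of_mem hP hmem
    apply h
    intro k
    fin_cases k
    · change a 0 ≤ m 0; omega
    · change a 1 ≤ m 1; omega
    · change a 2 ≤ m 2; omega

lemma coord_le_totalDegree (Q : MvPolynomial (Fin 3) ℚ) {a : Fin 3 →₀ ℕ} (ha : a ∈ Q.support)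
    (k : Fin 3) : a k ≤ Q.totalDegree := by
  have h := MvPolynomial.le_totalDegree ha
  refine le_trans ?_ h
  by_cases hk : a k = 0
  · omega
  · exact Finset.single_le_sum (f := fun k => a k) (fun _ _ => Nat.zero_le _)
      (Finsupp.mem_support_iff.2 hk)

theorem gammaPrime_no_rational_strategy
    (P : Set (ℤ × ℤ × ℤ)) (hP : PPosProperty gammaPrime P) :
    ¬ ∃ (Pp Qq : MvPolynomial (Fin 3) ℚ), MvPolynomial.coeff 0 Qq ≠ 0 ∧
        (Qq : MvPowerSeries (Fin 3) ℚ) * genFun P = (Pp : MvPowerSeries (Fin 3) ℚ) := by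
  rintro ⟨Pp, Qq, hQ0, hEq⟩
  obtain ⟨n, hn⟩ : ∃ n, n = Pp.totalDegree + Qq.totalDegree + 30 := ⟨_, rfl⟩
  have hlt : n < 2 ^ n := Nat.lt_two_pow_self
  obtain ⟨M, hM⟩ : ∃ M : ℕ, M = 2 ^ n := ⟨_, rfl⟩
  rw [← hM] at hlt
  have hMZ : (M : ℤ) = ((2 ^ n : ℕ) : ℤ) := by rw [hM]
  -- the vanishing of the coefficients of the product
  have vanish : ∀ X Y : ℕ, Pp.totalDegree < X →
      ∑ a ∈ Qq.support, MvPolynomial.coeff a Qq *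
        indic P ((X : ℤ) - a 0, (Y : ℤ) - a 1, (1 : ℤ) - a 2) = 0 := by
    intro X Y hX
    have h := coeff_mul_genFun hP Qq (Finsupp.equivFunOnFinite.symm ![X, Y, 1])
    rw [hEq, MvPolynomial.coeff_coe] at h
    have h0 : MvPolynomial.coeff (Finsupp.equivFunOnFinite.symm ![X, Y, 1]) Pp = 0 := by
      by_contra hne
      have := coord_le_totalDegree Pp (MvPolynomial.mem_support_iff.2 hne) 0
      simp at this
      omega
    rw [h0] at h
    simpa using h.symm
  have v1 := vanish (6 * M - 2) (6 * M - 1) (by omega)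
  have v2 := vanish (6 * M - 8) (6 * M - 1) (by omega)
  rw [show ((6 * M - 2 : ℕ) : ℤ) = 6 * M - 2 by omega,
    show ((6 * M - 1 : ℕ) : ℤ) = 6 * M - 1 by omega] at v1
  rw [show ((6 * M - 8 : ℕ) : ℤ) = 6 * M - 8 by omega,
    show ((6 * M - 1 : ℕ) : ℤ) = 6 * M - 1 by omega] at v2
  have v3 := congrArg₂ (· - ·) v1 v2
  simp only [sub_zero] at v3
  rw [← Finset.sum_sub_distrib] at v3
  obtain ⟨c1, c2⟩ := corner hP n M hMZ (by omega)
  rw [Finset.sum_eq_single 0] at v3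
  · simp only [Finsupp.coe_zero, Pi.zero_apply, Nat.cast_zero, sub_zero] at v3
    rw [show (6 * M - 2 - 6 : ℤ) = 6 * M - 8 by ring] at c2
    unfold indic at v3
    rw [if_pos c1, if_neg c2] at v3
    apply hQ0
    simpa using v3
  · intro a ha hne
    have d0 := coord_le_totalDegree Qq ha 0
    have d1 := coord_le_totalDegree Qq ha 1
    rw [← mul_sub]
    apply mul_eq_zero_of_right
    rw [sub_eq_zero]
    have key : ((6 * (M : ℤ) - 2 - a 0, 6 * (M : ℤ) - 1 - a 1, (1 : ℤ) - a 2) ∈ P ↔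
        (6 * (M : ℤ) - 8 - a 0, 6 * (M : ℤ) - 1 - a 1, (1 : ℤ) - a 2) ∈ P) := by
      rw [show 6 * (M : ℤ) - 8 - a 0 = 6 * (M : ℤ) - 2 - a 0 - 6 by ring]
      rcases Nat.lt_or_ge (a 2) 2 with h2 | h2
      · by_cases h20 : a 2 = 0
        · rw [h20, Nat.cast_zero, sub_zero]
          refine window hP n M hMZ _ _ (by omega) (by omega) (by omega) (by omega) ?_
          intro hh
          apply hne
          ext k
          fin_cases k
          · change a 0 = 0; omega
          · change a 1 = 0; omega
          · change a 2 = 0; omega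
        · rw [show a 2 = 1 by omega, Nat.cast_one, sub_self, mem_zero hP (by omega) (by omega),
            mem_zero hP (by omega) (by omega)]
          unfold bottom
          omega
      · constructor <;> intro h <;> have := (nonneg_of_mem hP h).2.2 <;> omega
    unfold indic
    by_cases hk : (6 * (M : ℤ) - 2 - a 0, 6 * (M : ℤ) - 1 - a 1, (1 : ℤ) - a 2) ∈ P
    · rw [if_pos hk, if_pos (key.1 hk)]
    · rw [if_neg hk, if_neg (fun h => hk (key.2 h))]
  · intro h0
    rw [MvPolynomial.notMem_support_iff] at h0
    exact absurd h0 hQ0
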